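/- arXiv:2204.00319 — 8 statements merged into one kernel-verified Lean document; each statement's English description precedes it below -/
import Mathlib

section
/- Let R be a commutative ring and M an R-module equipped with a bilinear form ⟨·,·⟩ : M × M → R that is alternating (⟨x,x⟩ = 0 for all x). Define the operation x ▷ y := x + ⟨x,y⟩ • y. Then ▷ satisfies the quandle axioms: (i) x ▷ x = x for all x ∈ M; (ii) for each fixed y ∈ M the map x ↦ x ▷ y is a bijection of M whose inverse is x ↦ x − ⟨x,y⟩ • y; and (iii) the self-distributivity law (x ▷ y) ▷ z = (x ▷ z) ▷ (y ▷ z) holds for all x, y, z ∈ M. -/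
/-- The symplectic quandle operation `x ▷ y = x + ⟨x,y⟩ • y` associated to an
alternating bilinear form satisfies the quandle axioms. -/
theorem symplectic_quandle_axioms {R : Type*} [CommRing R] {M : Type*}
    [AddCommGroup M] [Module R M] (B : M →ₗ[R] M →ₗ[R] R)
    (halt : ∀ x : M, B x x = 0) :
    (∀ x : M, x + B x x • x = x) ∧
    (∀ y : M,
      Function.Bijective (fun x : M => x + B x y • y) ∧
      Function.LeftInverse (fun x : M => x - B x y • y)
        (fun x : M => x + B x y • y) ∧
      Function.RightInverse (fun x : M => x - B x y • y)
        (fun x : M => x + B x y • y)) ∧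
    (∀ x y z : M,
      (x + B x y • y) + B (x + B x y • y) z • z =
        (x + B x z • z) +
          B (x + B x z • z) (y + B y z • z) • (y + B y z • z)) := by
  have hl (y : M) : Function.LeftInverse (fun x : M => x - B x y • y)
      (fun x : M => x + B x y • y) := fun x => by simp [halt]
  have hr (y : M) : Function.RightInverse (fun x : M => x - B x y • y)
      (fun x : M => x + B x y • y) := fun x => by simp [halt]
  refine ⟨fun x => by simp [halt],
    fun y => ⟨⟨(hl y).injective, (hr y).surjective⟩, hl y, hr y⟩, fun x y z => ?_⟩
  have hzy : B z y = -B y z := (LinearMap.IsAlt.neg halt y z).symm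
  have hB : B (x + B x z • z) (y + B y z • z) = B x y := by
    simp only [map_add, map_smul, LinearMap.add_apply, LinearMap.smul_apply, smul_eq_mul,
      halt, hzy]
    ring
  rw [hB]
  simp only [map_add, map_smul, LinearMap.add_apply, LinearMap.smul_apply, smul_eq_mul]
  module
end

section
/- For all vectors a, b, c ∈ ℂ², the trace of the triple product satisfies tr(M(a)·M(b)·M(c)) = 2 − ⟨a,b⟩² − ⟨a,c⟩² − ⟨b,c⟩² − ⟨a,b⟩·⟨b,c⟩·⟨a,c⟩. -/
/-- The parabolic quandle map `(x, y) ↦ [[1 - xy, x²], [-y², 1 + xy]]`. -/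
noncomputable def Mpar (v : ℂ × ℂ) : Matrix.SpecialLinearGroup (Fin 2) ℂ :=
  ⟨!![1 - v.1 * v.2, v.1 ^ 2; -v.2 ^ 2, 1 + v.1 * v.2], by
    rw [Matrix.det_fin_two_of]; ring⟩

/-- The determinant pairing `⟨a,b⟩ = a₁b₂ - a₂b₁` on `ℂ²`. -/
noncomputable def dpair (a b : ℂ × ℂ) : ℂ := a.1 * b.2 - a.2 * b.1

/-- `tr(M(a)·M(b)·M(c)) = 2 - ⟨a,b⟩² - ⟨a,c⟩² - ⟨b,c⟩² - ⟨a,b⟩⟨b,c⟩⟨a,c⟩`. -/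
theorem trace_Mpar_triple (a b c : ℂ × ℂ) :
    Matrix.trace ((Mpar a : Matrix (Fin 2) (Fin 2) ℂ) *
        (Mpar b : Matrix (Fin 2) (Fin 2) ℂ) *
        (Mpar c : Matrix (Fin 2) (Fin 2) ℂ)) =
      2 - (dpair a b) ^ 2 - (dpair a c) ^ 2 - (dpair b c) ^ 2 -
        dpair a b * dpair b c * dpair a c := by
  simp only [Mpar, dpair, Matrix.trace_fin_two, Matrix.mul_apply, Fin.sum_univ_two,
    Matrix.of_apply, Matrix.cons_val', Matrix.cons_val_zero, Matrix.cons_val_one,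
    Matrix.cons_val_fin_one]
  ring
end

section
/- Two matrices A, B ∈ SL(2,ℂ) with tr(A) = tr(B) = 2 commute (A·B = B·A) if and only if tr(A·B) = 2. -/
/-- Two traceless, determinant-zero matrices `!![x, y; z, -x]` and `!![u, v; w, -u]` commute
iff their product has trace zero. -/
theorem nilpotent_entries_commute_iff {R : Type*} [CommRing R] [IsDomain R]
    {x y z u v w : R} (hN : x ^ 2 + y * z = 0) (hM : u ^ 2 + v * w = 0) :
    (y * w = z * v ∧ x * v = u * y ∧ x * w = u * z) ↔ 2 * (x * u) + y * w + z * v = 0 := by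
  constructor
  · rintro ⟨h₁, h₂, h₃⟩
    have h : x * u + y * w = 0 := by
      apply pow_eq_zero_iff two_ne_zero |>.mp
      linear_combination u ^ 2 * hN + y * z * hM + 2 * u * y * h₃ + y * w * h₁
    linear_combination 2 * h - h₁
  · intro h
    refine ⟨?_, ?_, ?_⟩ <;> apply sub_eq_zero.mp <;> apply pow_eq_zero_iff two_ne_zero |>.mp
    · linear_combination (y * w + z * v - 2 * x * u) * h + 4 * u ^ 2 * hN - 4 * y * z * hM
    · linear_combination v ^ 2 * hN + y ^ 2 * hM - y * v * h
    · linear_combination w ^ 2 * hN + z ^ 2 * hM - z * w * h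

/-- Two trace-2 matrices in `SL(2,ℂ)` commute iff their product has trace 2. -/
theorem trace_two_commute_iff (A B : Matrix.SpecialLinearGroup (Fin 2) ℂ)
    (hA : Matrix.trace (A : Matrix (Fin 2) (Fin 2) ℂ) = 2)
    (hB : Matrix.trace (B : Matrix (Fin 2) (Fin 2) ℂ) = 2) :
    A * B = B * A ↔
      Matrix.trace ((A : Matrix (Fin 2) (Fin 2) ℂ) *
        (B : Matrix (Fin 2) (Fin 2) ℂ)) = 2 := by
  have hdA := A.det_coe
  have hdB := B.det_coe
  rw [Matrix.det_fin_two] at hdA hdB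
  rw [Matrix.trace_fin_two] at hA hB
  have key := nilpotent_entries_commute_iff
    (x := A 0 0 - 1) (y := A 0 1) (z := A 1 0) (u := B 0 0 - 1) (v := B 0 1) (w := B 1 0)
    (by linear_combination A 0 0 * hA - hdA) (by linear_combination B 0 0 * hB - hdB)
  have hcomm : A * B = B * A ↔ A 0 1 * B 1 0 = A 1 0 * B 0 1 ∧
      (A 0 0 - 1) * B 0 1 = (B 0 0 - 1) * A 0 1 ∧
      (A 0 0 - 1) * B 1 0 = (B 0 0 - 1) * A 1 0 := by
    rw [Matrix.SpecialLinearGroup.ext_iff, Matrix.SpecialLinearGroup.coe_mul,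
      Matrix.SpecialLinearGroup.coe_mul]
    simp only [Fin.forall_fin_two, Matrix.mul_apply, Fin.sum_univ_two]
    constructor
    · rintro ⟨⟨h₁, h₂⟩, h₃, h₄⟩
      refine ⟨?_, ?_, ?_⟩
      · linear_combination h₁
      · linear_combination (h₂ + B 0 1 * hA - A 0 1 * hB) / 2
      · linear_combination (-h₃ + B 1 0 * hA - A 1 0 * hB) / 2
    · rintro ⟨h₁, h₂, h₃⟩
      refine ⟨⟨?_, ?_⟩, ?_, ?_⟩
      · linear_combination h₁
      · linear_combination 2 * h₂ - B 0 1 * hA + A 0 1 * hB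
      · linear_combination -2 * h₃ + B 1 0 * hA - A 1 0 * hB
      · linear_combination -h₁
  rw [hcomm, key, Matrix.trace_fin_two]
  simp only [Matrix.mul_apply, Fin.sum_univ_two]
  constructor
  · intro h
    linear_combination h + B 1 1 * hA + (2 - A 0 0) * hB
  · intro h
    linear_combination h - B 1 1 * hA - (2 - A 0 0) * hB
end

section
/- For all vectors a, b ∈ ℂ², the matrices M(a) and M(b) commute in SL(2,ℂ) if and only if ⟨a,b⟩ = 0 (equivalently, if and only if a and b are linearly dependent over ℂ or one of them is zero). -/
theorem Mpar_commute_iff_dpair_eq_zero (a b : ℂ × ℂ) :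
    Mpar a * Mpar b = Mpar b * Mpar a ↔ dpair a b = 0 := by
  obtain ⟨x, y⟩ := a
  obtain ⟨z, w⟩ := b
  have key : Mpar (x, y) * Mpar (z, w) = Mpar (z, w) * Mpar (x, y) ↔
      !![1 - x * y, x ^ 2; -y ^ 2, 1 + x * y] * !![1 - z * w, z ^ 2; -w ^ 2, 1 + z * w] =
      !![1 - z * w, z ^ 2; -w ^ 2, 1 + z * w] * !![1 - x * y, x ^ 2; -y ^ 2, 1 + x * y] :=
    Subtype.ext_iff
  rw [key, Matrix.mul_fin_two, Matrix.mul_fin_two]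
  simp only [dpair]
  constructor
  · intro h
    have h00 := congrFun (congrFun h 0) 0
    have h01 := congrFun (congrFun h 0) 1
    simp only [Matrix.of_apply, Matrix.cons_val_zero, Matrix.cons_val_one] at h00 h01
    have hcube : (x * w - y * z) ^ 3 = 0 := by
      linear_combination (-(x * w + y * z)) * h00 - 2 * y * w * h01
    exact pow_eq_zero_iff (by norm_num) |>.mp hcube
  · intro h
    congr! 3
    · linear_combination (-(x * w + y * z)) * h
    · congr! 1
      linear_combination 2 * x * z * h
    · congr! 1
      · linear_combination (-2 * y * w) * h
      · congr! 1
        linear_combination (x * w + y * z) * h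

theorem linearIndependent_pair_iff_dpair_ne_zero (a b : ℂ × ℂ) :
    LinearIndependent ℂ ![a, b] ↔ dpair a b ≠ 0 := by
  obtain ⟨x, y⟩ := a
  obtain ⟨z, w⟩ := b
  simp only [LinearIndependent.pair_iff, dpair, Prod.smul_mk, Prod.mk_add_mk, smul_eq_mul,
    Prod.mk_eq_zero]
  constructor
  · intro h hd
    obtain ⟨hw, hy⟩ := h w (-y) ⟨by linear_combination hd, by ring⟩
    obtain ⟨hz, hx⟩ := h z (-x) ⟨by ring, by linear_combination -hd⟩
    rw [neg_eq_zero] at hx hy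
    have h10 := h 1 0 ⟨by simp [hx], by simp [hy]⟩
    exact one_ne_zero h10.1
  · rintro hd s t ⟨h₁, h₂⟩
    exact ⟨(mul_eq_zero.mp (by linear_combination w * h₁ - z * h₂ :
        s * (x * w - y * z) = 0)).resolve_right hd,
      (mul_eq_zero.mp (by linear_combination x * h₂ - y * h₁ :
        t * (x * w - y * z) = 0)).resolve_right hd⟩

/-- `M(a)` and `M(b)` commute iff `⟨a,b⟩ = 0`, equivalently iff `a` and `b` are
linearly dependent over `ℂ` or one of them is zero. -/
theorem Mpar_commute_iff (a b : ℂ × ℂ) :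
    (Mpar a * Mpar b = Mpar b * Mpar a ↔ dpair a b = 0) ∧
    (dpair a b = 0 ↔ (¬ LinearIndependent ℂ ![a, b] ∨ a = 0 ∨ b = 0)) := by
  refine ⟨Mpar_commute_iff_dpair_eq_zero a b, ?_⟩
  rw [linearIndependent_pair_iff_dpair_ne_zero, not_not]
  refine ⟨Or.inl, ?_⟩
  rintro (h | rfl | rfl)
  · exact h
  · simp [dpair]
  · simp [dpair]
end

section
/- Let N be a natural number, let a : Fin N → ℂ² be a family of vectors, and let Γ be the subgroup of SL(2,ℂ) generated by the matrices M(a i) for i : Fin N. Then for every γ ∈ Γ, the trace of γ lies in the subfield of ℂ generated over ℚ by all the pairings ⟨a i, a j⟩ for i, j : Fin N. (This is the inclusion of the trace field of a parabolic representation into its u-field.) -/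
/-- The action of a `2 × 2` matrix on `ℂ × ℂ`. -/
def Matrix.actProd (A : Matrix (Fin 2) (Fin 2) ℂ) (v : ℂ × ℂ) : ℂ × ℂ :=
  (A 0 0 * v.1 + A 0 1 * v.2, A 1 0 * v.1 + A 1 1 * v.2)

theorem trace_mul_Mpar (A : Matrix (Fin 2) (Fin 2) ℂ) (v : ℂ × ℂ) :
    (A * (Mpar v : Matrix (Fin 2) (Fin 2) ℂ)).trace = A.trace + dpair v (A.actProd v) := by
  simp [Mpar, dpair, Matrix.actProd, Matrix.trace_fin_two, Matrix.mul_apply, Fin.sum_univ_two]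
  ring

theorem trace_mul_Mpar_inv (A : Matrix (Fin 2) (Fin 2) ℂ) (v : ℂ × ℂ) :
    (A * ((Mpar v)⁻¹ : Matrix.SpecialLinearGroup (Fin 2) ℂ).val).trace =
      A.trace - dpair v (A.actProd v) := by
  rw [Matrix.SpecialLinearGroup.coe_inv]
  simp [Mpar, dpair, Matrix.actProd, Matrix.trace_fin_two, Matrix.mul_apply, Fin.sum_univ_two,
    Matrix.adjugate_fin_two]
  ring

theorem dpair_actProd_mul_Mpar (A : Matrix (Fin 2) (Fin 2) ℂ) (v u w : ℂ × ℂ) :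
    dpair u ((A * (Mpar v : Matrix (Fin 2) (Fin 2) ℂ)).actProd w) =
      dpair u (A.actProd w) + dpair v w * dpair u (A.actProd v) := by
  simp [Mpar, dpair, Matrix.actProd, Matrix.mul_apply, Fin.sum_univ_two]
  ring

theorem dpair_actProd_mul_Mpar_inv (A : Matrix (Fin 2) (Fin 2) ℂ) (v u w : ℂ × ℂ) :
    dpair u ((A * ((Mpar v)⁻¹ : Matrix.SpecialLinearGroup (Fin 2) ℂ).val).actProd w) =
      dpair u (A.actProd w) - dpair v w * dpair u (A.actProd v) := by
  rw [Matrix.SpecialLinearGroup.coe_inv]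
  simp [Mpar, dpair, Matrix.actProd, Matrix.mul_apply, Fin.sum_univ_two,
    Matrix.adjugate_fin_two]
  ring

/-- If a subfield contains all pairings of the vectors `a i`, it contains the traces and the matrix
coefficients `⟨a i, γ (a j)⟩` of all elements `γ` of the group generated by the `M(a i)`. -/
theorem trace_mem_and_dpair_actProd_mem {ι : Type*} (K : Subfield ℂ) (a : ι → ℂ × ℂ)
    (ha : ∀ i j, dpair (a i) (a j) ∈ K) (γ : Matrix.SpecialLinearGroup (Fin 2) ℂ)
    (hγ : γ ∈ Subgroup.closure (Set.range fun i => Mpar (a i))) :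
    γ.val.trace ∈ K ∧ ∀ i j, dpair (a i) (γ.val.actProd (a j)) ∈ K := by
  induction hγ using Subgroup.closure_induction_right with
  | one =>
    refine ⟨by simp, fun i j => ?_⟩
    simpa [Matrix.actProd] using ha i j
  | mul_right x _ y hy ih =>
    obtain ⟨k, rfl⟩ := hy
    simp only [Matrix.SpecialLinearGroup.coe_mul, trace_mul_Mpar, dpair_actProd_mul_Mpar]
    exact ⟨add_mem ih.1 (ih.2 k k),
      fun i j => add_mem (ih.2 i j) (mul_mem (ha k j) (ih.2 i k))⟩
  | mul_inv_cancel x _ y hy ih =>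
    obtain ⟨k, rfl⟩ := hy
    rw [Matrix.SpecialLinearGroup.coe_mul]
    simp only [trace_mul_Mpar_inv, dpair_actProd_mul_Mpar_inv]
    exact ⟨sub_mem ih.1 (ih.2 k k),
      fun i j => sub_mem (ih.2 i j) (mul_mem (ha k j) (ih.2 i k))⟩

/-- The trace of any element of the subgroup of `SL(2,ℂ)` generated by the
`M(a i)` lies in the subfield of `ℂ` generated (over `ℚ`) by the pairings
`⟨a i, a j⟩`: the trace field is contained in the u-field. -/
theorem trace_mem_ufield (N : ℕ) (a : Fin N → ℂ × ℂ)
    (γ : Matrix.SpecialLinearGroup (Fin 2) ℂ)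
    (hγ : γ ∈ Subgroup.closure (Set.range fun i => Mpar (a i))) :
    Matrix.trace (γ : Matrix (Fin 2) (Fin 2) ℂ) ∈
      Subfield.closure {x : ℂ | ∃ i j : Fin N, x = dpair (a i) (a j)} := by
  refine (trace_mem_and_dpair_actProd_mem _ a (fun i j => ?_) γ hγ).1
  exact Subfield.subset_closure ⟨i, j, rfl⟩
end

section
/- Let u ∈ ℂ be algebraic over ℚ, let y = u², and let R₀ ∈ ℚ[X] be the minimal polynomial of y over ℚ. Then u belongs to ℚ(y) (the subfield of ℂ generated by u² over ℚ) if and only if the polynomial R₀(X²) (the composition of R₀ with X²) is reducible in ℚ[X], i.e. is not irreducible. -/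
open IntermediateField Polynomial in
/-- An integral element `u` of a field extension `L / K` lies in `K(u²)` iff the minimal polynomial
of `u²`, composed with `X²`, is not irreducible. -/
theorem IsIntegral.mem_adjoin_sq_iff {K L : Type*} [Field K] [Field L] [Algebra K L] {u : L}
    (hu : IsIntegral K u) :
    u ∈ K⟮u ^ 2⟯ ↔ ¬ Irreducible ((minpoly K (u ^ 2)).comp (X ^ 2)) := by
  have hy : IsIntegral K (u ^ 2) := hu.pow 2
  have hmonic : ((minpoly K (u ^ 2)).comp (X ^ 2)).Monic :=
    (minpoly.monic hy).comp (monic_X_pow 2) (by simp)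
  have hroot : aeval u ((minpoly K (u ^ 2)).comp (X ^ 2)) = 0 := by
    simp [aeval_comp]
  have hdeg : ((minpoly K (u ^ 2)).comp (X ^ 2)).natDegree = Module.finrank K K⟮u ^ 2⟯ * 2 := by
    rw [natDegree_comp, natDegree_X_pow, adjoin.finrank hy]
  have hle : K⟮u ^ 2⟯ ≤ K⟮u⟯ :=
    adjoin_simple_le_iff.2 (pow_mem (mem_adjoin_simple_self K u) 2)
  have : FiniteDimensional K K⟮u⟯ := adjoin.finiteDimensional hu
  have : FiniteDimensional K K⟮u ^ 2⟯ := adjoin.finiteDimensional hy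
  have hpos : 0 < Module.finrank K K⟮u ^ 2⟯ := Module.finrank_pos
  constructor
  · intro hmem hirr
    have heq : K⟮u⟯ = K⟮u ^ 2⟯ := le_antisymm (adjoin_simple_le_iff.2 hmem) hle
    rw [minpoly.eq_of_irreducible_of_monic hirr hroot hmonic, ← adjoin.finrank hu, heq] at hdeg
    omega
  · contrapose
    intro hmem
    obtain ⟨k, hk⟩ : Module.finrank K K⟮u ^ 2⟯ ∣ Module.finrank K K⟮u⟯ :=
      finrank_dvd_of_le_right hle
    have hlt : Module.finrank K K⟮u ^ 2⟯ < Module.finrank K K⟮u⟯ := by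
      by_contra! h
      exact hmem (eq_of_le_of_finrank_le hle h ▸ mem_adjoin_simple_self K u)
    have hk2 : 2 ≤ k := by
      by_contra! h
      interval_cases k <;> omega
    have heq : (minpoly K (u ^ 2)).comp (X ^ 2) = minpoly K u := by
      refine eq_of_monic_of_dvd_of_natDegree_le (minpoly.monic hu) hmonic
        (minpoly.dvd K u hroot) ?_
      rw [hdeg, ← adjoin.finrank hu, hk]
      exact Nat.mul_le_mul_left _ hk2
    exact heq ▸ minpoly.irreducible hu

/-- For `u` algebraic over `ℚ` and `y = u²` with minimal polynomial `R₀`,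
`u ∈ ℚ(y)` iff `R₀(X²)` is reducible in `ℚ[X]`. -/
theorem mem_adjoin_sq_iff_not_irreducible (u : ℂ) (hu : IsAlgebraic ℚ u) :
    u ∈ IntermediateField.adjoin ℚ ({u ^ 2} : Set ℂ) ↔
      ¬ Irreducible ((minpoly ℚ (u ^ 2)).comp (Polynomial.X ^ 2)) :=
  hu.isIntegral.mem_adjoin_sq_iff
end

section
/- Let u ∈ ℂ be algebraic over ℚ, let y = u², and let g₀ ∈ ℚ[X] be the minimal polynomial of u over ℚ. Then u belongs to ℚ(y) (the subfield of ℂ generated by u² over ℚ) if and only if g₀ has a nonzero coefficient in some odd degree. -/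
/-- Decomposition of a polynomial into its even and odd parts. -/
theorem Polynomial.expand_contract_two_add {R : Type*} [CommRing R] (p : Polynomial R) :
    expand R 2 (contract 2 p) + X * expand R 2 (contract 2 p.divX) = p := by
  ext n
  rcases n with _ | n
  · simp [coeff_expand, coeff_contract]
  · rw [coeff_add, coeff_X_mul, coeff_expand two_pos, coeff_expand two_pos,
      coeff_contract two_ne_zero, coeff_contract two_ne_zero, coeff_divX]
    rcases Nat.even_or_odd n with h | h
    · have h2 : ¬ 2 ∣ n + 1 := by have := h.two_dvd; lia
      rw [if_neg h2, if_pos h.two_dvd, Nat.div_mul_cancel h.two_dvd, zero_add]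
    · have h2 : 2 ∣ n + 1 := h.add_one.two_dvd
      have h3 : ¬ 2 ∣ n := by lia
      rw [if_pos h2, if_neg h3, Nat.div_mul_cancel h2, add_zero]

/-- For `u` algebraic over `ℚ` with minimal polynomial `g₀` and `y = u²`,
`u ∈ ℚ(y)` iff `g₀` has a nonzero coefficient in some odd degree. -/
theorem mem_adjoin_sq_iff_odd_coeff (u : ℂ) (hu : IsAlgebraic ℚ u) :
    u ∈ IntermediateField.adjoin ℚ ({u ^ 2} : Set ℂ) ↔
      ∃ n : ℕ, Odd n ∧ (minpoly ℚ u).coeff n ≠ 0 := by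
  have hdec := Polynomial.expand_contract_two_add (minpoly ℚ u)
  set E := Polynomial.contract 2 (minpoly ℚ u)
  set O := Polynomial.contract 2 (minpoly ℚ u).divX with hO
  have hOcoeff (n : ℕ) : O.coeff n = (minpoly ℚ u).coeff (2 * n + 1) := by
    rw [hO, Polynomial.coeff_contract two_ne_zero, Polynomial.coeff_divX, mul_comm]
  constructor
  · intro h
    by_contra! hodd
    have hO0 : O = 0 := by
      ext n
      rw [hOcoeff, hodd _ (odd_two_mul_add_one n), Polynomial.coeff_zero]
    have hE : Polynomial.expand ℚ 2 E = minpoly ℚ u := by simpa [hO0] using hdec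
    rw [← IntermediateField.mem_toSubalgebra,
      IntermediateField.adjoin_simple_toSubalgebra_of_isAlgebraic (hu.pow 2),
      Algebra.adjoin_singleton_eq_range_aeval] at h
    obtain ⟨q, hq⟩ := h
    replace hq : Polynomial.aeval (u ^ 2) q = u := hq
    have hdvd : minpoly ℚ u ∣ Polynomial.expand ℚ 2 q - Polynomial.X :=
      minpoly.dvd ℚ u (by simp [Polynomial.expand_aeval, hq])
    have hneg : Polynomial.aeval (-u) (minpoly ℚ u) = 0 := by
      rw [← hE, Polynomial.expand_aeval, neg_sq, ← Polynomial.expand_aeval, hE, minpoly.aeval]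
    have hroot := Polynomial.aeval_eq_zero_of_dvd_aeval_eq_zero hdvd hneg
    rw [map_sub, Polynomial.expand_aeval, neg_sq, hq, Polynomial.aeval_X, sub_neg_eq_add,
      add_self_eq_zero] at hroot
    have := hodd 1 odd_one
    simp [hroot, minpoly.zero] at this
  · rintro ⟨n, ⟨k, rfl⟩, hn⟩
    have hO0 : O ≠ 0 := fun h ↦ hn (by rw [← hOcoeff, h, Polynomial.coeff_zero])
    have hOdeg : (Polynomial.expand ℚ 2 O).natDegree < (minpoly ℚ u).natDegree := by
      have hlead : (minpoly ℚ u).coeff (2 * O.natDegree + 1) ≠ 0 := by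
        rw [← hOcoeff]
        exact Polynomial.leadingCoeff_ne_zero.mpr hO0
      have := Polynomial.le_natDegree_of_ne_zero hlead
      rw [Polynomial.natDegree_expand]
      lia
    have hOy : Polynomial.aeval (u ^ 2) O ≠ 0 := by
      intro h
      rw [← Polynomial.expand_aeval] at h
      have hne : Polynomial.expand ℚ 2 O ≠ 0 := (Polynomial.expand_ne_zero two_pos).mpr hO0
      exact absurd (Polynomial.natDegree_le_of_dvd (minpoly.dvd ℚ u h) hne) hOdeg.not_ge
    have heq := congrArg (Polynomial.aeval u) hdec
    rw [map_add, map_mul, Polynomial.expand_aeval, Polynomial.expand_aeval, Polynomial.aeval_X,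
      minpoly.aeval] at heq
    have hu_eq : u = -Polynomial.aeval (u ^ 2) E / Polynomial.aeval (u ^ 2) O := by
      rw [eq_div_iff hOy]
      linear_combination heq
    have hmem (p : Polynomial ℚ) :
        Polynomial.aeval (u ^ 2) p ∈ IntermediateField.adjoin ℚ ({u ^ 2} : Set ℂ) :=
      IntermediateField.algebra_adjoin_le_adjoin ℚ _ (Polynomial.aeval_mem_adjoin_singleton ℚ _)
    simpa only [← hu_eq] using div_mem (neg_mem (hmem E)) (hmem O)
end

section
/- Let u ∈ ℂ be algebraic over ℚ, let y = u², let R₀ ∈ ℚ[X] be the minimal polynomial of y over ℚ and g₀ ∈ ℚ[X] the minimal polynomial of u over ℚ. If u belongs to ℚ(y), then R₀(X²) = g₀(X) · g₀*(X) in ℚ[X], where g₀*(X) := (−1)^{deg g₀} · g₀(−X). -/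
open Polynomial in
/-- Over a domain of characteristic zero, a polynomial invariant under `X ↦ -X` is a polynomial
in `X ^ 2`. -/
theorem Polynomial.expand_two_contract_of_comp_neg_X_eq {R : Type*} [CommRing R] [IsDomain R]
    [CharZero R] {p : R[X]} (hp : p.comp (-X) = p) : expand R 2 (contract 2 p) = p := by
  ext n
  rw [coeff_expand two_pos, coeff_contract two_ne_zero]
  split_ifs with h
  · rw [Nat.div_mul_cancel h]
  · have hodd : Odd n := by rwa [← Nat.not_even_iff_odd, even_iff_two_dvd]
    have hX : (-X : R[X]) = C (-1) * X := by simp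
    have hn : (p.comp (-X)).coeff n = p.coeff n := by rw [hp]
    rw [hX, comp_C_mul_X_coeff, hodd.neg_one_pow, mul_neg_one] at hn
    exact (self_eq_neg.1 hn.symm).symm

/-- If `u` is algebraic over `ℚ`, `y = u²`, `R₀ = minpoly ℚ y`,
`g₀ = minpoly ℚ u`, and `u ∈ ℚ(y)`, then `R₀(X²) = g₀(X) · g₀*(X)` where
`g₀*(X) = (-1)^(deg g₀) · g₀(-X)`. -/
theorem minpoly_sq_comp_eq_mul_star (u : ℂ) (hu : IsAlgebraic ℚ u)
    (hmem : u ∈ IntermediateField.adjoin ℚ ({u ^ 2} : Set ℂ)) :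
    (minpoly ℚ (u ^ 2)).comp (Polynomial.X ^ 2) =
      minpoly ℚ u *
        ((-1 : Polynomial ℚ) ^ (minpoly ℚ u).natDegree *
          (minpoly ℚ u).comp (-Polynomial.X)) := by
  have hint : IsIntegral ℚ u := hu.isIntegral
  have hadj : IntermediateField.adjoin ℚ ({u ^ 2} : Set ℂ) =
      IntermediateField.adjoin ℚ ({u} : Set ℂ) :=
    le_antisymm
      (IntermediateField.adjoin_simple_le_iff.2
        (pow_mem (IntermediateField.mem_adjoin_simple_self ℚ u) 2))
      (IntermediateField.adjoin_simple_le_iff.2 hmem)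
  have hdeg : (minpoly ℚ (u ^ 2)).natDegree = (minpoly ℚ u).natDegree := by
    rw [← IntermediateField.adjoin.finrank hint,
      ← IntermediateField.adjoin.finrank (hint.pow 2), hadj]
  set g := minpoly ℚ u
  have hmonic : g.Monic := minpoly.monic hint
  set p := g * ((-1 : Polynomial ℚ) ^ g.natDegree * g.comp (-Polynomial.X)) with hp
  have hstar : ((-1 : Polynomial ℚ) ^ g.natDegree * g.comp (-Polynomial.X)).Monic :=
    hmonic.neg_one_pow_natDegree_mul_comp_neg_X
  have hpmonic : p.Monic := hmonic.mul hstar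
  have hpdeg : p.natDegree = g.natDegree * 2 := by
    have h : ((-1 : Polynomial ℚ) ^ g.natDegree * g.comp (-Polynomial.X)).natDegree =
        g.natDegree := by
      rcases neg_one_pow_eq_or (Polynomial ℚ) g.natDegree with h | h <;>
        simp [h, Polynomial.natDegree_comp]
    rw [hp, hmonic.natDegree_mul hstar, h, mul_two]
  have hexp : Polynomial.expand ℚ 2 (Polynomial.contract 2 p) = p := by
    refine Polynomial.expand_two_contract_of_comp_neg_X_eq ?_
    simp only [hp, Polynomial.mul_comp, Polynomial.pow_comp, Polynomial.neg_comp,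
      Polynomial.one_comp, Polynomial.comp_assoc, Polynomial.X_comp, neg_neg, Polynomial.comp_X]
    ring
  have hroot : Polynomial.aeval (u ^ 2) (Polynomial.contract 2 p) = 0 := by
    rw [← Polynomial.expand_aeval, hexp, hp, map_mul, minpoly.aeval, zero_mul]
  have hcmonic : (Polynomial.contract 2 p).Monic := by
    rwa [← Polynomial.monic_expand_iff two_pos, hexp]
  have hcdeg : (Polynomial.contract 2 p).natDegree = g.natDegree := by
    have h := Polynomial.natDegree_expand 2 (Polynomial.contract 2 p)
    rw [hexp, hpdeg] at h
    omega
  have hc : Polynomial.contract 2 p = minpoly ℚ (u ^ 2) :=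
    Polynomial.eq_of_monic_of_dvd_of_natDegree_le (minpoly.monic (hint.pow 2)) hcmonic
      (minpoly.dvd ℚ _ hroot) (hcdeg.trans hdeg.symm).le
  rw [← Polynomial.expand_eq_comp_X_pow, ← hc, hexp]
end
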